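/- arXiv:1503.02430 — 2 statements merged into one kernel-verified Lean document; each statement's English description precedes it below -/
import Mathlib

section
/- Let T be a positive operator on a complex Banach lattice E with r(T) = 1, and suppose that every peripheral spectral value of T (i.e. every element of σ(T) ∩ {z : |z| = 1}) is a pole of the resolvent. Then the following are equivalent: (i) for every weighting scheme (f_j)_{j∈J}, the set {f_j(T) : j ∈ J} is bounded in operator norm; (ii) T is (WS)-bounded, i.e. there is at least one weighting scheme (f_j)_{j∈J} such that {f_j(T) : j ∈ J} is bounded in operator norm; (iii) the spectral radius r(T) = 1 is a first order pole of the resolvent; (iv) every peripheral spectral value of T is a first order pole of the resolvent. -/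
open scoped ComplexOrder ENNReal
open Filter Topology

noncomputable section

/-- A complex Banach lattice: a complex Banach space `E = E_ℝ ⊕ i E_ℝ` which is the
complexification of a real Banach lattice `E_ℝ` (the set `real`), equipped with the
partial order induced by the positive cone of `E_ℝ` and with the lattice modulus
`|z| = sup_θ |Re (e^{iθ} z)|` (the map `modulus`), whose norm satisfies `‖z‖ = ‖|z|‖`
and is a lattice norm. -/
class ComplexBanachLattice (E : Type*) [NormedAddCommGroup E] [NormedSpace ℂ E]
    [PartialOrder E] where
  /-- The real part `E_ℝ` of `E`. -/
  real : Set E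
  real_zero : (0 : E) ∈ real
  real_add : ∀ x ∈ real, ∀ y ∈ real, x + y ∈ real
  real_neg : ∀ x ∈ real, -x ∈ real
  real_smul : ∀ (r : ℝ), ∀ x ∈ real, (r : ℂ) • x ∈ real
  /-- `E = E_ℝ ⊕ i E_ℝ`. -/
  real_decomp : ∀ z : E, ∃ x ∈ real, ∃ y ∈ real, z = x + Complex.I • y
  /-- Positive elements are real. -/
  nonneg_mem_real : ∀ x : E, 0 ≤ x → x ∈ real
  /-- The order is determined by the positive cone. -/
  le_iff_sub_nonneg : ∀ x y : E, x ≤ y ↔ 0 ≤ y - x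
  smul_nonneg : ∀ (r : ℝ), 0 ≤ r → ∀ x : E, 0 ≤ x → 0 ≤ (r : ℂ) • x
  /-- The real part is a (vector) lattice: binary suprema of real elements exist. -/
  real_sup_exists : ∀ x ∈ real, ∀ y ∈ real, ∃ s ∈ real, IsLUB {x, y} s
  /-- The modulus map `z ↦ |z|`. -/
  modulus : E → E
  modulus_nonneg : ∀ z : E, 0 ≤ modulus z
  modulus_eq_zero_iff : ∀ z : E, modulus z = 0 ↔ z = 0
  modulus_add_le : ∀ z w : E, modulus (z + w) ≤ modulus z + modulus w
  modulus_smul : ∀ (c : ℂ) (z : E), modulus (c • z) = (‖c‖ : ℂ) • modulus z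
  /-- On real elements the modulus is the lattice modulus, i.e. the supremum of `x` and `-x`. -/
  modulus_isLUB : ∀ x ∈ real, IsLUB {x, -x} (modulus x)
  norm_modulus : ∀ z : E, ‖modulus z‖ = ‖z‖
  /-- The norm is a lattice norm. -/
  norm_mono : ∀ x y : E, modulus x ≤ modulus y → ‖x‖ ≤ ‖y‖

/-- The real part `E_ℝ` of a complex Banach lattice. -/
def latticeRealPart (E : Type*) [NormedAddCommGroup E] [NormedSpace ℂ E] [PartialOrder E]
    [ComplexBanachLattice E] : Set E :=
  ComplexBanachLattice.real

/-- A bounded linear operator on a complex Banach lattice is positive if it maps the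
positive cone into itself. -/
def IsPositiveOp {E : Type*} [NormedAddCommGroup E] [NormedSpace ℂ E] [PartialOrder E]
    [ComplexBanachLattice E] (T : E →L[ℂ] E) : Prop :=
  ∀ x : E, 0 ≤ x → 0 ≤ T x

/-- `a : ℕ → ℂ` is the coefficient sequence of a function analytic on (a neighbourhood of)
the closed unit disk `𝔻̄`: its power series around `0` has radius of convergence `> 1`. -/
def HasDiskRadius (a : ℕ → ℂ) : Prop :=
  ∃ ρ : ℝ, 1 < ρ ∧ ∀ z : ℂ, ‖z‖ < ρ → Summable fun k => a k * z ^ k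

/-- A net `(f_j)_{j ∈ J}` (along a filter `F` on the index type `J`) of functions analytic on
the closed unit disk, given by their power series coefficients `a j : ℕ → ℂ` around `0`, is a
weighting scheme if (WS1) `f_j(1) = Σ_k a_{j,k} = 1` for each `j`, (WS2) `f_j^{(k)}(0) ≥ 0`,
i.e. `a_{j,k} ≥ 0`, for all `j, k`, and (WS3) `f_j(z) → 0` along the net for every `|z| < 1`. -/
def IsWeightingScheme {J : Type*} (F : Filter J) (a : J → ℕ → ℂ) : Prop :=
  (∀ j, HasDiskRadius (a j)) ∧
  (∀ j, (∑' k, a j k) = 1) ∧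
  (∀ j k, 0 ≤ a j k) ∧
  (∀ z : ℂ, ‖z‖ < 1 → Tendsto (fun j => ∑' k, a j k * z ^ k) F (nhds 0))

/-- For `f` analytic on the closed unit disk with power series `Σ_k a_k z^k` around `0` and an
operator `T` with `r(T) = 1`, the operator `f(T) := Σ_k a_k T^k`. -/
def wsApply {E : Type*} [NormedAddCommGroup E] [NormedSpace ℂ E]
    (a : ℕ → ℂ) (T : E →L[ℂ] E) : E →L[ℂ] E :=
  ∑' k, a k • T ^ k

/-- An operator `T` (with `r(T) = 1`) is (WS)-bounded if there is a weighting scheme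
`(f_j)_{j ∈ J}` such that `{f_j(T) : j ∈ J}` is bounded in operator norm. -/
def WSBounded {E : Type*} [NormedAddCommGroup E] [NormedSpace ℂ E] (T : E →L[ℂ] E) : Prop :=
  ∃ (J : Type) (F : Filter J), F.NeBot ∧
    ∃ a : J → ℕ → ℂ, IsWeightingScheme F a ∧ ∃ C : ℝ, ∀ j : J, ‖wsApply (a j) T‖ ≤ C

/-- `μ₀` is an `m`-th order pole of the resolvent of `T`: `μ₀` is an isolated point of the
spectrum of `T` and the resolvent map `μ ↦ R(μ,T)` has a pole of order `m` at `μ₀`, i.e.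
`μ ↦ (μ - μ₀)^m R(μ,T)` extends analytically near `μ₀` with nonzero value at `μ₀`. -/
def HasResolventPoleOfOrder {X : Type*} [NormedAddCommGroup X] [NormedSpace ℂ X]
    [CompleteSpace X] (T : X →L[ℂ] X) (μ₀ : ℂ) (m : ℕ) : Prop :=
  μ₀ ∈ spectrum ℂ T ∧
  (∃ ε : ℝ, 0 < ε ∧ ∀ μ : ℂ, μ ≠ μ₀ → ‖μ - μ₀‖ < ε → μ ∉ spectrum ℂ T) ∧
  ∃ g : ℂ → (X →L[ℂ] X), AnalyticAt ℂ g μ₀ ∧ g μ₀ ≠ 0 ∧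
    ∀ᶠ μ in nhdsWithin μ₀ {μ₀}ᶜ, (μ - μ₀) ^ m • resolvent T μ = g μ

section PowerSeries

variable {X : Type*} [NormedAddCommGroup X] [NormedSpace ℂ X] [CompleteSpace X]

/-- A function with removable singularities agrees with an analytic function. -/
theorem analyticAt_limUnder_nhdsNE {f h : ℂ → X} {z : ℂ} (hh : AnalyticAt ℂ h z)
    (hfh : f =ᶠ[𝓝[≠] z] h) : AnalyticAt ℂ (fun w => limUnder (𝓝[≠] w) f) z := by
  refine hh.congr ?_
  have hev : ∀ᶠ w in 𝓝 z, f =ᶠ[𝓝[≠] w] h := by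
    have h1 : ∀ᶠ w in 𝓝 z, w ≠ z → f w = h w := eventually_nhdsWithin_iff.1 hfh
    filter_upwards [h1.eventually_nhds] with w hw
    by_cases hwz : w = z
    · rwa [hwz]
    · filter_upwards [nhdsWithin_le_nhds hw, nhdsWithin_le_nhds (isOpen_ne.mem_nhds hwz)]
        with v hv hvz using hv hvz
  filter_upwards [hev, hh.eventually_analyticAt] with w hw hhw
  exact ((hhw.continuousAt.tendsto.mono_left nhdsWithin_le_nhds).congr' hw.symm).limUnder_eq.symm

/-- The Taylor coefficients of a function having at most removable singularities in the closed
unit disk are bounded. -/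
theorem exists_norm_coeff_le {f : ℂ → X} {c : ℕ → X}
    (hc : ∀ᶠ z in 𝓝 (0 : ℂ), HasSum (fun k => z ^ k • c k) (f z))
    (hf : ∀ z : ℂ, ‖z‖ ≤ 1 → ∃ h : ℂ → X, AnalyticAt ℂ h z ∧ f =ᶠ[𝓝[≠] z] h) :
    ∃ C : ℝ, ∀ k, ‖c k‖ ≤ C := by
  set F : ℂ → X := fun w => limUnder (𝓝[≠] w) f with hF
  have hFan : ∀ z : ℂ, ‖z‖ ≤ 1 → AnalyticAt ℂ F z := fun z hz => by
    obtain ⟨h, hh, hfh⟩ := hf z hz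
    exact analyticAt_limUnder_nhdsNE hh hfh
  let q : FormalMultilinearSeries ℂ ℂ X :=
    fun n => ContinuousMultilinearMap.mkPiRing ℂ (Fin n) (c n)
  have hq : HasFPowerSeriesAt f q 0 := by
    rw [hasFPowerSeriesAt_iff]
    filter_upwards [hc] with z hz
    simpa [q, FormalMultilinearSeries.coeff] using hz
  have hqF : HasFPowerSeriesAt F q 0 := by
    refine hq.congr ?_
    filter_upwards [hq.analyticAt.eventually_analyticAt] with w hw
    exact (hw.continuousAt.tendsto.mono_left nhdsWithin_le_nhds).limUnder_eq.symm
  obtain ⟨δ, hδ, hsub⟩ := (isCompact_closedBall (0 : ℂ) 1).exists_cthickening_subset_open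
    (isOpen_analyticAt ℂ F) (fun z hz => hFan z (by simpa using hz))
  rw [cthickening_closedBall hδ.le zero_le_one] at hsub
  let R : NNReal := ⟨δ + 1, by positivity⟩
  have hR : (1 : NNReal) < R := by
    change (1 : ℝ) < δ + 1
    linarith
  have hps : HasFPowerSeriesOnBall F (cauchyPowerSeries F 0 R) 0 R :=
    DifferentiableOn.hasFPowerSeriesOnBall
      (fun z hz => (hsub hz).differentiableAt.differentiableWithinAt) (zero_lt_one.trans hR)
  rw [hps.hasFPowerSeriesAt.eq_formalMultilinearSeries hqF] at hps
  obtain ⟨C, -, hC⟩ := q.norm_mul_pow_le_of_lt_radius (r := 1)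
    (lt_of_lt_of_le (by exact_mod_cast hR) hps.r_le)
  refine ⟨C, fun k => ?_⟩
  simpa [q, ContinuousMultilinearMap.norm_mkPiRing] using hC k

end PowerSeries

section BanachAlgebra

variable {A : Type*} [NormedRing A] [NormedAlgebra ℂ A]

theorem inverse_one_sub_smul_inv (a : A) {μ : ℂ} (hμ : μ ≠ 0) :
    Ring.inverse (1 - μ⁻¹ • a) = μ • resolvent a μ := by
  have hu : algebraMap ℂ A μ - a = μ • (1 - μ⁻¹ • a) := by
    rw [smul_sub, smul_inv_smul₀ hμ, Algebra.algebraMap_eq_smul_one]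
  rw [resolvent, hu]
  by_cases h : IsUnit (1 - μ⁻¹ • a)
  · obtain ⟨u, hu'⟩ := h
    rw [← hu', Ring.inverse_unit]
    let v : Aˣ := ⟨μ • (u : A), μ⁻¹ • (↑u⁻¹ : A),
      by rw [smul_mul_smul_comm, mul_inv_cancel₀ hμ, one_smul, Units.mul_inv],
      by rw [smul_mul_smul_comm, inv_mul_cancel₀ hμ, one_smul, Units.inv_mul]⟩
    rw [show Ring.inverse (μ • (u : A)) = μ⁻¹ • (↑u⁻¹ : A) from Ring.inverse_unit v,
      smul_inv_smul₀ hμ]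
  · have h' : ¬ IsUnit (μ • (1 - μ⁻¹ • a)) := fun h' =>
      h ((isUnit_smul_iff (Units.mk0 μ hμ) (1 - μ⁻¹ • a)).1 h')
    rw [Ring.inverse_non_unit _ h, Ring.inverse_non_unit _ h', smul_zero]

variable [CompleteSpace A]

theorem eventually_norm_pow_le_of_spectralRadius_lt {a : A} {ρ : ℝ}
    (h : spectralRadius ℂ a < ENNReal.ofReal ρ) : ∀ᶠ k : ℕ in atTop, ‖a ^ k‖ ≤ ρ ^ k := by
  filter_upwards [(spectrum.pow_norm_pow_one_div_tendsto_nhds_spectralRadius a).eventually_lt_const h,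
    eventually_gt_atTop 0] with k hk hk0
  have h1 : ‖a ^ k‖ ^ (1 / k : ℝ) < ρ :=
    (ENNReal.ofReal_lt_ofReal_iff_of_nonneg (by positivity)).1 hk
  have h2 : (‖a ^ k‖ ^ (1 / k : ℝ)) ^ k = ‖a ^ k‖ := by
    rw [one_div, Real.rpow_inv_natCast_pow (norm_nonneg _) hk0.ne']
  rw [← h2]
  exact pow_le_pow_left₀ (by positivity) h1.le k

theorem summable_smul_pow_of_spectralRadius_lt {a : A} {ρ : ℝ}
    (h : spectralRadius ℂ a < ENNReal.ofReal ρ) {c : ℕ → ℂ}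
    (hc : Summable fun k => c k * (ρ : ℂ) ^ k) : Summable fun k => c k • a ^ k := by
  have hρ : 0 < ρ := ENNReal.ofReal_pos.1 (bot_le.trans_lt h)
  refine Summable.of_norm_bounded_eventually_nat hc.norm ?_
  filter_upwards [eventually_norm_pow_le_of_spectralRadius_lt h] with k hk
  rw [norm_smul, norm_mul, norm_pow (ρ : ℂ), Complex.norm_real, Real.norm_of_nonneg hρ.le]
  exact mul_le_mul_of_nonneg_left hk (norm_nonneg _)

theorem hasSum_resolvent {a : A} (ha : spectralRadius ℂ a = 1) {μ : ℂ} (hμ : 1 < ‖μ‖) :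
    HasSum (fun k => (μ⁻¹) ^ (k + 1) • a ^ k) (resolvent a μ) := by
  have hμ0 : μ ≠ 0 := by
    rintro rfl
    norm_num at hμ
  obtain ⟨ρ, hρ1, hρ⟩ := exists_between hμ
  have hs : Summable fun k => (μ⁻¹ • a) ^ k := by
    simp_rw [smul_pow]
    refine summable_smul_pow_of_spectralRadius_lt (ρ := ρ) (by rw [ha]; simpa using hρ1) ?_
    simp_rw [← mul_pow]
    refine summable_geometric_of_norm_lt_one ?_
    rw [norm_mul, norm_inv, Complex.norm_real, Real.norm_of_nonneg (by linarith),
      inv_mul_lt_iff₀ (by linarith)]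
    linarith
  have hu : algebraMap ℂ A μ - a = μ • (1 - μ⁻¹ • a) := by
    rw [smul_sub, smul_inv_smul₀ hμ0, Algebra.algebraMap_eq_smul_one]
  have hres : resolvent a μ = μ⁻¹ • ∑' k, (μ⁻¹ • a) ^ k := by
    let u : Aˣ := ⟨algebraMap ℂ A μ - a, μ⁻¹ • ∑' k, (μ⁻¹ • a) ^ k,
      by rw [hu, smul_mul_smul_comm, mul_inv_cancel₀ hμ0, one_smul, hs.one_sub_mul_tsum_pow],
      by rw [hu, smul_mul_smul_comm, inv_mul_cancel₀ hμ0, one_smul, hs.tsum_pow_mul_one_sub]⟩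
    exact Ring.inverse_unit u
  rw [hres]
  simpa [smul_pow, smul_smul, pow_succ'] using hs.hasSum.const_smul (μ⁻¹)

end BanachAlgebra

section ResolventPole

variable {X : Type*} [NormedAddCommGroup X] [NormedSpace ℂ X]

theorem pow_mul_of_jordan_chain {T S Q : X →L[ℂ] X} (hS : T * S = S) (hQ : T * Q = Q + S) (k : ℕ) :
    T ^ k * Q = Q + (k : ℂ) • S := by
  induction k with
  | zero => simp
  | succ k ih =>
    rw [pow_succ', mul_assoc, ih, mul_add, hQ, mul_smul_comm, hS]
    push_cast
    module

variable [CompleteSpace X]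

theorem finite_peripheral_spectrum {T : X →L[ℂ] X}
    (h : ∀ μ ∈ spectrum ℂ T, ‖μ‖ = 1 →
      ∃ ε : ℝ, 0 < ε ∧ ∀ ν : ℂ, ν ≠ μ → ‖ν - μ‖ < ε → ν ∉ spectrum ℂ T) :
    {μ ∈ spectrum ℂ T | ‖μ‖ = 1}.Finite := by
  have hcomp : IsCompact {μ ∈ spectrum ℂ T | ‖μ‖ = 1} :=
    (spectrum.isCompact T).inter_right (isClosed_eq continuous_norm continuous_const)
  by_contra hinf
  obtain ⟨x, hx, hacc⟩ := Set.Infinite.exists_accPt_of_subset_isCompact hinf hcomp Set.Subset.rfl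
  obtain ⟨ε, hε, hiso⟩ := h x hx.1 hx.2
  obtain ⟨y, ⟨hyε, hy⟩, hyx⟩ := accPt_iff_nhds.1 hacc _ (Metric.ball_mem_nhds x hε)
  exact hiso y hyx (by simpa [dist_eq_norm] using hyε) hy.1

theorem exists_norm_pow_le_of_simple_poles {T : X →L[ℂ] X} (hr : spectralRadius ℂ T = 1)
    (h : ∀ μ ∈ spectrum ℂ T, ‖μ‖ = 1 → HasResolventPoleOfOrder T μ 1) :
    ∃ C : ℝ, ∀ k, ‖T ^ k‖ ≤ C := by
  have hfin := finite_peripheral_spectrum (T := T) (fun μ hμ hμ1 => (h μ hμ hμ1).2.1)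
  have hK : ∀ μ : ℂ, μ ∈ hfin.toFinset ↔ μ ∈ spectrum ℂ T ∧ ‖μ‖ = 1 := fun μ => by simp
  set K := hfin.toFinset with hKdef
  have hg : ∀ μ : ℂ, ∃ g : ℂ → (X →L[ℂ] X), μ ∈ K → AnalyticAt ℂ g μ ∧
      ∀ᶠ ν in 𝓝[≠] μ, (ν - μ) • resolvent T ν = g ν := fun μ => by
    by_cases hμ : μ ∈ K
    · obtain ⟨-, -, g, hg, -, hge⟩ := h μ ((hK μ).1 hμ).1 ((hK μ).1 hμ).2
      exact ⟨g, fun _ => ⟨hg, by simpa using hge⟩⟩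
    · exact ⟨0, fun h => absurd h hμ⟩
  choose g hg using hg
  set f : ℂ → (X →L[ℂ] X) := fun z =>
    Ring.inverse (1 - z • T) - ∑ μ ∈ K, (1 - z * μ)⁻¹ • g μ μ with hf
  obtain ⟨C, hC⟩ : ∃ C : ℝ, ∀ k, ‖T ^ k - ∑ μ ∈ K, μ ^ k • g μ μ‖ ≤ C := by
    refine exists_norm_coeff_le (f := f) ?_ ?_
    · have hball : ∀ᶠ z in 𝓝 (0 : ℂ), ‖z‖ < 1 :=
        (continuous_norm.tendsto' (0 : ℂ) 0 norm_zero).eventually_lt_const one_pos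
      have hinv := (hasFPowerSeriesAt_iff.1
        (spectrum.hasFPowerSeriesOnBall_inverse_one_sub_smul ℂ T).hasFPowerSeriesAt)
      filter_upwards [hball, hinv] with z hz hTz
      have h1 : HasSum (fun k => z ^ k • T ^ k) (Ring.inverse (1 - z • T)) := by
        simpa [FormalMultilinearSeries.coeff] using hTz
      have h2 : ∀ μ ∈ K, HasSum (fun k => z ^ k • μ ^ k • g μ μ) ((1 - z * μ)⁻¹ • g μ μ) := by
        intro μ hμ
        have := (hasSum_geometric_of_norm_lt_one (ξ := z * μ)
          (by rwa [norm_mul, ((hK μ).1 hμ).2, mul_one])).smul_const (g μ μ)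
        simpa [mul_pow, smul_smul] using this
      simpa [smul_sub, Finset.smul_sum] using h1.sub (hasSum_sum h2)
    · intro z hz
      by_cases hzK : z⁻¹ ∈ K
      · set μ := z⁻¹ with hμ
        have hμ1 := ((hK μ).1 hzK).2
        have hz0 : z ≠ 0 := by
          rintro rfl
          simp [hμ] at hμ1
        have hμ0 : μ ≠ 0 := inv_ne_zero hz0
        obtain ⟨hgan, hge⟩ := hg μ hzK
        have hinvan : AnalyticAt ℂ (fun w : ℂ => w⁻¹) z := analyticAt_inv hz0
        have hds : AnalyticAt ℂ (dslope (g μ) μ) μ := by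
          obtain ⟨p, hp⟩ := hgan
          exact ⟨_, hp.has_fpower_series_dslope_fslope⟩
        refine ⟨fun w => w⁻¹ • dslope (g μ) μ w⁻¹ - ∑ ν ∈ K.erase μ, (1 - w * ν)⁻¹ • g ν ν,
          ?_, ?_⟩
        · refine (hinvan.fun_smul (AnalyticAt.fun_comp (f := fun w : ℂ => w⁻¹) hds hinvan)).fun_sub ?_
          refine Finset.analyticAt_fun_sum _ fun ν hν => ?_
          refine AnalyticAt.fun_smul (AnalyticAt.fun_inv (by fun_prop) ?_) analyticAt_const
          intro h0
          refine (Finset.mem_erase.1 hν).1 ?_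
          rw [hμ]
          exact (inv_eq_of_mul_eq_one_right (sub_eq_zero.1 h0).symm).symm
        · have htend : Tendsto (fun w : ℂ => w⁻¹) (𝓝[≠] z) (𝓝[≠] μ) := by
            refine tendsto_nhdsWithin_iff.2
              ⟨(tendsto_inv₀ hz0).mono_left nhdsWithin_le_nhds, ?_⟩
            filter_upwards [self_mem_nhdsWithin] with w hw
            simpa [hμ] using hw
          have hne : ∀ᶠ w in 𝓝[≠] z, w ≠ 0 := nhdsWithin_le_nhds (isOpen_ne.mem_nhds hz0)
          filter_upwards [htend.eventually hge, hne, self_mem_nhdsWithin] with w hw hw0 hwz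
          have hwμ : w⁻¹ ≠ μ := fun h' => hwz (inv_injective h')
          have hsub : w⁻¹ - μ ≠ 0 := sub_ne_zero.2 hwμ
          have h1 : Ring.inverse (1 - w • T) = w⁻¹ • resolvent T w⁻¹ := by
            have := inverse_one_sub_smul_inv T (inv_ne_zero hw0)
            rwa [inv_inv] at this
          have h2 : resolvent T w⁻¹ = (w⁻¹ - μ)⁻¹ • g μ w⁻¹ := by
            rw [← hw, inv_smul_smul₀ hsub]
          have h3 : (1 - w * μ)⁻¹ = w⁻¹ * (w⁻¹ - μ)⁻¹ := by
            rw [← mul_inv, mul_sub, mul_inv_cancel₀ hw0]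
          simp only [hf]
          rw [← Finset.add_sum_erase _ _ hzK, h1, h2, h3, dslope_of_ne _ hwμ, slope_def_module,
            smul_sub, smul_sub, smul_smul, smul_smul]
          abel
      · refine ⟨f, ?_, EventuallyEq.rfl⟩
        have hu : IsUnit (1 - z • T) := by
          rcases eq_or_ne z 0 with rfl | hz0
          · simp
          have hmem : z⁻¹ ∈ resolventSet ℂ T := by
            by_contra hs
            have hle : ‖z⁻¹‖ ≤ 1 := by
              have := spectrum.mem_resolventSet_of_spectralRadius_lt (𝕜 := ℂ) (a := T) (k := z⁻¹)
              rw [hr] at this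
              by_contra hlt
              exact hs (this (by exact_mod_cast not_le.1 hlt))
            refine hzK ((hK _).2 ⟨hs, le_antisymm hle ?_⟩)
            rw [norm_inv]
            exact (one_le_inv₀ (norm_pos_iff.2 hz0)).2 hz
          have hmem' : IsUnit (algebraMap ℂ (X →L[ℂ] X) z⁻¹ - T) := hmem
          have := (isUnit_smul_iff (Units.mk0 z hz0) _).2 hmem'
          rwa [Units.smul_def, Units.val_mk0, smul_sub, Algebra.algebraMap_eq_smul_one,
            smul_inv_smul₀ hz0] at this
        refine AnalyticAt.fun_sub ?_ ?_
        · obtain ⟨u, hu⟩ := hu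
          refine AnalyticAt.fun_comp (g := Ring.inverse) (f := fun w : ℂ => 1 - w • T) ?_ (by fun_prop)
          rw [← hu]
          exact analyticAt_inverse u
        · refine Finset.analyticAt_fun_sum _ fun ν hν => ?_
          refine AnalyticAt.fun_smul (AnalyticAt.fun_inv (by fun_prop) ?_) analyticAt_const
          intro h0
          refine hzK ?_
          rwa [inv_eq_of_mul_eq_one_right (sub_eq_zero.1 h0).symm]
  refine ⟨C + ∑ μ ∈ K, ‖g μ μ‖, fun k => ?_⟩
  calc ‖T ^ k‖ = ‖(T ^ k - ∑ μ ∈ K, μ ^ k • g μ μ) + ∑ μ ∈ K, μ ^ k • g μ μ‖ := by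
        rw [sub_add_cancel]
    _ ≤ C + ∑ μ ∈ K, ‖g μ μ‖ := by
        refine (norm_add_le _ _).trans (add_le_add (hC k) ((norm_sum_le _ _).trans ?_))
        refine Finset.sum_le_sum fun μ hμ => ?_
        rw [norm_smul, norm_pow, ((hK μ).1 hμ).2, one_pow, one_mul]

/-- At a pole of order `m ≥ 2` located at `1`, the two leading Laurent coefficients `S` and `Q`
of the resolvent form a Jordan chain. -/
theorem exists_jordan_chain {T : X →L[ℂ] X} {m : ℕ} (hm : 2 ≤ m)
    (h : HasResolventPoleOfOrder T 1 m) :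
    ∃ S Q : X →L[ℂ] X, S ≠ 0 ∧ T * S = S ∧ T * Q = Q + S := by
  obtain ⟨-, ⟨ε, hε, hiso⟩, g, hg, hg1, hge⟩ := h
  have hev : (fun μ : ℂ => (μ • (1 : X →L[ℂ] X) - T) * g μ) =ᶠ[𝓝[≠] 1]
      fun μ => (μ - 1) ^ m • (1 : X →L[ℂ] X) := by
    filter_upwards [hge, self_mem_nhdsWithin, nhdsWithin_le_nhds (Metric.ball_mem_nhds 1 hε)]
      with μ hμ hμ1 hμε
    have hres : μ ∈ resolventSet ℂ T := by
      by_contra hs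
      exact hiso μ hμ1 (by simpa [dist_eq_norm] using hμε) hs
    have hu : IsUnit (μ • (1 : X →L[ℂ] X) - T) := by
      rw [← Algebra.algebraMap_eq_smul_one]
      exact hres
    rw [← hμ, resolvent, Algebra.algebraMap_eq_smul_one, mul_smul_comm, Ring.mul_inverse_cancel _ hu]
  have hd1 : HasDerivAt (fun μ : ℂ => (μ • (1 : X →L[ℂ] X) - T) * g μ)
      (((1 : ℂ) • (1 : X →L[ℂ] X)) * g 1 + ((1 : ℂ) • (1 : X →L[ℂ] X) - T) * deriv g 1) 1 :=
    (((hasDerivAt_id (1 : ℂ)).smul_const (1 : X →L[ℂ] X)).sub_const T).mul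
      hg.differentiableAt.hasDerivAt
  have hd2 : HasDerivAt (fun μ : ℂ => (μ - 1) ^ m • (1 : X →L[ℂ] X)) 0 1 := by
    have := (((hasDerivAt_id (1 : ℂ)).sub_const 1).fun_pow m).smul_const (1 : X →L[ℂ] X)
    have hm1 : m - 1 ≠ 0 := by omega
    simpa [hm1] using this
  have hev' := (hd1.continuousAt.eventuallyEq_nhds_iff_eventuallyEq_nhdsNE hd2.continuousAt).1 hev
  have h0 := hev'.self_of_nhds
  have h1 := hd1.unique (hd2.congr_of_eventuallyEq hev')
  have hm0 : m ≠ 0 := by omega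
  simp only [one_smul, sub_self, ne_eq, hm0, not_false_eq_true, zero_pow, zero_smul, sub_mul,
    one_mul] at h0 h1
  refine ⟨g 1, deriv g 1, hg1, (sub_eq_zero.1 h0).symm, ?_⟩
  rw [← sub_eq_zero, ← neg_eq_zero, ← h1]
  abel

end ResolventPole

section WeightingScheme

theorem exists_real_weights {a : ℕ → ℂ} (ha : ∀ k, 0 ≤ a k) :
    ∃ b : ℕ → ℝ, (∀ k, 0 ≤ b k) ∧ ∀ k, a k = b k :=
  ⟨fun k => (a k).re, fun k => (Complex.nonneg_iff.1 (ha k)).1, fun k =>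
    Complex.ext rfl (Complex.nonneg_iff.1 (ha k)).2.symm⟩

theorem HasDiskRadius.summable {a : ℕ → ℂ} (ha : HasDiskRadius a) : Summable a := by
  obtain ⟨ρ, hρ, h⟩ := ha
  simpa using h 1 (by simpa using hρ)

theorem HasDiskRadius.summable_mul_pow {a : ℕ → ℂ} (ha : HasDiskRadius a) {z : ℂ} (hz : ‖z‖ ≤ 1) :
    Summable fun k => a k * z ^ k := by
  obtain ⟨ρ, hρ, h⟩ := ha
  exact h z (hz.trans_lt hρ)

theorem isWeightingScheme_powers :
    IsWeightingScheme (atTop : Filter ℕ) (fun n k => if k = n then (1 : ℂ) else 0) := by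
  refine ⟨fun n => ⟨2, one_lt_two, fun z _ => ?_⟩, fun n => tsum_ite_eq n _, fun n k => ?_,
    fun z hz => ?_⟩
  · refine summable_of_ne_finset_zero (s := {n}) fun k hk => ?_
    simp [show k ≠ n by simpa using hk]
  · change (0 : ℂ) ≤ if k = n then 1 else 0
    split_ifs
    · exact zero_le_one
    · exact le_rfl
  · refine (tendsto_pow_atTop_nhds_zero_of_norm_lt_one hz).congr fun n => ?_
    simp [ite_mul]

variable {X : Type*} [NormedAddCommGroup X] [NormedSpace ℂ X]

theorem norm_wsApply_le {T : X →L[ℂ] X} {C : ℝ} (hC : ∀ k, ‖T ^ k‖ ≤ C) {a : ℕ → ℂ}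
    (has : Summable a) (ha0 : ∀ k, 0 ≤ a k) (ha1 : ∑' k, a k = 1) : ‖wsApply a T‖ ≤ C := by
  obtain ⟨b, hb0, hb⟩ := exists_real_weights ha0
  have hab : a = fun k => (b k : ℂ) := funext hb
  rw [hab] at has ha1
  have hbs : Summable b := Complex.summable_ofReal.1 has
  have hb1 : ∑' k, b k = 1 := by exact_mod_cast (Complex.ofReal_tsum b).trans ha1
  have hsum : HasSum (fun k => b k * C) C := by
    simpa [hb1] using hbs.hasSum.mul_right C
  refine tsum_of_norm_bounded hsum fun k => ?_
  rw [norm_smul, hb, Complex.norm_real, Real.norm_of_nonneg (hb0 k)]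
  exact mul_le_mul_of_nonneg_left (hC k) (hb0 k)

variable [CompleteSpace X]

theorem HasDiskRadius.hasSum_wsApply {T : X →L[ℂ] X} (hr : spectralRadius ℂ T = 1) {a : ℕ → ℂ}
    (ha : HasDiskRadius a) : HasSum (fun k => a k • T ^ k) (wsApply a T) := by
  obtain ⟨ρ, hρ, h⟩ := ha
  obtain ⟨ρ', h1, h2⟩ := exists_between hρ
  refine (summable_smul_pow_of_spectralRadius_lt (ρ := ρ') (by rw [hr]; simpa using h1) ?_).hasSum
  refine h _ ?_
  rwa [Complex.norm_real, Real.norm_of_nonneg (by linarith)]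

/-- A Jordan chain of length two at `1` bounds the derivative at `1` of every weight function `f`
in terms of `‖f(T)‖`. -/
theorem summable_and_tsum_natCast_mul_le {T S Q : X →L[ℂ] X} (hr : spectralRadius ℂ T = 1)
    (hS0 : S ≠ 0) (hS : T * S = S) (hQ : T * Q = Q + S) {b : ℕ → ℝ} (hb0 : ∀ k, 0 ≤ b k)
    (hb : HasDiskRadius fun k => (b k : ℂ)) (hb1 : ∑' k, (b k : ℂ) = 1) {C : ℝ}
    (hC : ‖wsApply (fun k => (b k : ℂ)) T‖ ≤ C) :
    Summable (fun k => b k * k) ∧ ∑' k, b k * k ≤ (C * ‖Q‖ + ‖Q‖) / ‖S‖ := by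
  have h1 := (hb.hasSum_wsApply hr).mul_right Q
  have h2 : HasSum (fun k => (b k : ℂ) • Q) Q := by
    simpa [hb1] using hb.summable.hasSum.smul_const Q
  have h3 : HasSum (fun k => ((b k * k : ℝ) : ℂ) • S)
      (wsApply (fun k => (b k : ℂ)) T * Q - Q) := by
    convert! h1.sub h2 using 2 with k
    rw [smul_mul_assoc, pow_mul_of_jordan_chain hS hQ]
    push_cast
    module
  have hSn : ‖S‖ ≠ 0 := norm_ne_zero_iff.2 hS0
  have h4 : Summable fun k => b k * k := by
    obtain ⟨φ, -, hφ⟩ := exists_dual_vector ℂ S hSn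
    refine (summable_mul_right_iff hSn).1 (Complex.summable_ofReal.1 ?_)
    simpa [hφ] using (h3.mapL φ).summable
  refine ⟨h4, ?_⟩
  have h5 := (Complex.hasSum_ofReal.2 h4.hasSum).smul_const S
  have h6 := h3.unique h5
  have hn : 0 ≤ ∑' k, b k * k := tsum_nonneg fun k => mul_nonneg (hb0 k) k.cast_nonneg
  rw [le_div_iff₀ (norm_pos_iff.2 hS0)]
  calc (∑' k, b k * k) * ‖S‖ = ‖((∑' k, b k * k : ℝ) : ℂ) • S‖ := by
        rw [norm_smul, Complex.norm_real, Real.norm_of_nonneg hn]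
    _ = ‖wsApply (fun k => (b k : ℂ)) T * Q - Q‖ := by rw [h6]
    _ ≤ ‖wsApply (fun k => (b k : ℂ)) T * Q‖ + ‖Q‖ := norm_sub_le _ _
    _ ≤ C * ‖Q‖ + ‖Q‖ := by
        gcongr
        exact (norm_mul_le _ _).trans (mul_le_mul_of_nonneg_right hC (norm_nonneg _))

theorem not_wsBounded_of_jordan_chain {T S Q : X →L[ℂ] X} (hr : spectralRadius ℂ T = 1)
    (hS0 : S ≠ 0) (hS : T * S = S) (hQ : T * Q = Q + S) : ¬ WSBounded T := by
  rintro ⟨J, F, hF, a, ⟨had, ha1, ha0, hat⟩, C, hC⟩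
  set D := max ((C * ‖Q‖ + ‖Q‖) / ‖S‖) 0 with hD
  have hD0 : 0 ≤ D := le_max_right _ _
  set r : ℝ := 1 - (D + 2)⁻¹ with hr'
  have hinv : 0 < (D + 2)⁻¹ := by positivity
  have hinv1 : (D + 2)⁻¹ < 1 := inv_lt_one_of_one_lt₀ (by linarith)
  have hr0 : 0 ≤ r := by linarith
  have hr1 : r < 1 := by linarith
  have hnorm : ‖(r : ℂ)‖ < 1 := by rwa [Complex.norm_real, Real.norm_of_nonneg hr0]
  have key : ∀ j, 1 - D * (1 - r) ≤ ‖∑' k, a j k * (r : ℂ) ^ k‖ := by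
    intro j
    obtain ⟨b, hb0, hb⟩ := exists_real_weights (ha0 j)
    have hab : a j = fun k => (b k : ℂ) := funext hb
    have hd := had j
    have h1 := ha1 j
    have hCj := hC j
    rw [hab] at hd h1 hCj
    obtain ⟨hsk, hle⟩ := summable_and_tsum_natCast_mul_le hr hS0 hS hQ hb0 hd h1 hCj
    have hbs : Summable b := Complex.summable_ofReal.1 hd.summable
    have hb1 : ∑' k, b k = 1 := by exact_mod_cast (Complex.ofReal_tsum b).trans h1
    have hbr : Summable fun k => b k * r ^ k := by
      refine Complex.summable_ofReal.1 ?_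
      simpa using hd.summable_mul_pow hnorm.le
    have heq : ∑' k, a j k * (r : ℂ) ^ k = ((∑' k, b k * r ^ k : ℝ) : ℂ) := by
      rw [Complex.ofReal_tsum]
      simp [hb]
    have hcmp : ∑' k, b k - ∑' k, b k * r ^ k ≤ (∑' k, b k * k) * (1 - r) := by
      rw [← hbs.tsum_sub hbr, ← tsum_mul_right]
      refine (hbs.sub hbr).tsum_le_tsum (fun k => ?_) (hsk.mul_right _)
      have := mul_le_mul_of_nonneg_left (one_add_mul_sub_le_pow (by linarith : -1 ≤ r) k) (hb0 k)
      linarith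
    have hDle : (∑' k, b k * k) * (1 - r) ≤ D * (1 - r) :=
      mul_le_mul_of_nonneg_right (hle.trans (le_max_left _ _)) (by linarith)
    rw [heq, Complex.norm_real]
    refine le_trans ?_ (le_abs_self _)
    linarith
  have hlim := ge_of_tendsto' (hat r hnorm).norm key
  rw [norm_zero] at hlim
  have : (D + 2) * (D + 2)⁻¹ = 1 := mul_inv_cancel₀ (by linarith)
  nlinarith

end WeightingScheme

section Lattice

open ComplexBanachLattice

variable {E : Type*} [NormedAddCommGroup E] [NormedSpace ℂ E] [PartialOrder E]
  [ComplexBanachLattice E]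

theorem lattice_add_le_add {a b c d : E} (h₁ : a ≤ b) (h₂ : c ≤ d) : a + c ≤ b + d := by
  have h3 : a + c ≤ b + c := by
    rw [le_iff_sub_nonneg, add_sub_add_right_eq_sub]
    exact (le_iff_sub_nonneg a b).1 h₁
  have h4 : b + c ≤ b + d := by
    rw [le_iff_sub_nonneg, add_sub_add_left_eq_sub]
    exact (le_iff_sub_nonneg c d).1 h₂
  exact h3.trans h4

theorem modulus_of_nonneg {x : E} (hx : 0 ≤ x) : modulus x = x := by
  refine (modulus_isLUB x (nonneg_mem_real x hx)).unique ⟨?_, fun b hb => hb (by simp)⟩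
  have hneg : -x ≤ 0 := by
    rw [le_iff_sub_nonneg]
    simpa using hx
  rintro y (rfl | rfl)
  · exact le_rfl
  · exact hneg.trans hx

theorem modulus_zero : modulus (0 : E) = 0 := modulus_of_nonneg le_rfl

theorem lattice_smul_le_smul {r : ℝ} (hr : 0 ≤ r) {x y : E} (h : x ≤ y) :
    (r : ℂ) • x ≤ (r : ℂ) • y := by
  rw [le_iff_sub_nonneg, ← smul_sub]
  exact ComplexBanachLattice.smul_nonneg r hr _ ((le_iff_sub_nonneg x y).1 h)

theorem norm_le_norm_of_modulus_le {x y : E} (h : modulus x ≤ y) : ‖x‖ ≤ ‖y‖ := by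
  refine norm_mono x y ?_
  rwa [modulus_of_nonneg ((modulus_nonneg x).trans h)]

theorem modulus_sum_le {ι : Type*} (s : Finset ι) (f g : ι → E)
    (h : ∀ i ∈ s, modulus (f i) ≤ g i) : modulus (∑ i ∈ s, f i) ≤ ∑ i ∈ s, g i := by
  classical
  induction s using Finset.induction_on with
  | empty => simp [modulus_zero]
  | insert i s hi ih =>
    rw [Finset.sum_insert hi, Finset.sum_insert hi]
    exact (modulus_add_le _ _).trans (lattice_add_le_add (h i (Finset.mem_insert_self i s))
      (ih fun k hk => h k (Finset.mem_insert_of_mem hk)))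

theorem IsPositiveOp.pow {T : E →L[ℂ] E} (hT : IsPositiveOp T) (k : ℕ) : IsPositiveOp (T ^ k) := by
  induction k with
  | zero => exact fun x hx => by simpa using hx
  | succ k ih =>
    intro x hx
    rw [pow_succ']
    exact hT _ (ih x hx)

theorem IsPositiveOp.mono {T : E →L[ℂ] E} (hT : IsPositiveOp T) {x y : E} (h : x ≤ y) :
    T x ≤ T y := by
  rw [le_iff_sub_nonneg, ← map_sub]
  exact hT _ ((le_iff_sub_nonneg x y).1 h)

/-- Positive elements span, hence positive operators preserve the real part. -/
theorem IsPositiveOp.map_mem_real {T : E →L[ℂ] E} (hT : IsPositiveOp T) {x : E}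
    (hx : x ∈ (real : Set E)) : T x ∈ (real : Set E) := by
  have hle : x ≤ modulus x := (modulus_isLUB x hx).1 (by simp)
  have h1 := nonneg_mem_real _ (hT _ (modulus_nonneg x))
  have h2 := real_neg _ (nonneg_mem_real _ (hT _ ((le_iff_sub_nonneg _ _).1 hle)))
  have h3 := real_add _ h1 _ h2
  rwa [map_sub, neg_sub, add_sub_cancel] at h3

theorem IsPositiveOp.modulus_map_le {T : E →L[ℂ] E} (hT : IsPositiveOp T) {x : E}
    (hx : x ∈ (real : Set E)) : modulus (T x) ≤ T (modulus x) := by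
  refine (modulus_isLUB _ (hT.map_mem_real hx)).2 ?_
  rintro y (rfl | rfl)
  · exact hT.mono ((modulus_isLUB x hx).1 (by simp))
  · rw [← map_neg]
    exact hT.mono ((modulus_isLUB x hx).1 (by simp))

theorem ContinuousLinearMap.eq_zero_of_forall_real {S : E →L[ℂ] E}
    (h : ∀ x ∈ (real : Set E), S x = 0) : S = 0 := by
  ext z
  obtain ⟨x, hx, y, hy, rfl⟩ := real_decomp z
  simp [h x hx, h y hy]

variable [CompleteSpace E]

theorem IsPositiveOp.norm_resolvent_apply_le {T : E →L[ℂ] E} (hT : IsPositiveOp T)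
    (hr : spectralRadius ℂ T = 1) {μ : ℂ} (hμ : 1 < ‖μ‖) {x : E} (hx : x ∈ (real : Set E)) :
    ‖resolvent T μ x‖ ≤ ‖resolvent T (‖μ‖ : ℂ) (modulus x)‖ := by
  have h1 := ((hasSum_resolvent hr hμ).mapL (ContinuousLinearMap.apply ℂ E x)).tendsto_sum_nat
  have h2 := ((hasSum_resolvent hr (μ := (‖μ‖ : ℂ)) (by simpa using hμ)).mapL
    (ContinuousLinearMap.apply ℂ E (modulus x))).tendsto_sum_nat
  refine le_of_tendsto_of_tendsto' h1.norm h2.norm fun n => norm_le_norm_of_modulus_le ?_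
  refine modulus_sum_le _ _ _ fun k _ => ?_
  have hle := lattice_smul_le_smul (r := ‖μ‖⁻¹ ^ (k + 1)) (by positivity)
    ((hT.pow k).modulus_map_le hx)
  simpa [modulus_smul] using hle

/-- The resolvent of a positive operator grows at least as fast at the spectral radius as at any
other peripheral pole. -/
theorem IsPositiveOp.not_tendsto_of_pole {T : E →L[ℂ] E} (hT : IsPositiveOp T)
    (hr : spectralRadius ℂ T = 1) {l : ℂ} (hl : ‖l‖ = 1) {m : ℕ}
    (h : HasResolventPoleOfOrder T l m) :
    ¬ Tendsto (fun r : ℝ => (r - 1) ^ m * ‖resolvent T (r : ℂ)‖) (𝓝[>] 1) (𝓝 0) := by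
  intro hlim
  obtain ⟨-, -, g, hg, hg0, hge⟩ := h
  refine hg0 (ContinuousLinearMap.eq_zero_of_forall_real fun x hx => ?_)
  have hl0 : l ≠ 0 := by
    rintro rfl
    simp at hl
  have htend : Tendsto (fun r : ℝ => (r : ℂ) * l) (𝓝[>] 1) (𝓝[≠] l) := by
    refine tendsto_nhdsWithin_iff.2 ⟨?_, ?_⟩
    · have : Continuous fun r : ℝ => (r : ℂ) * l := by fun_prop
      exact (this.tendsto' 1 l (by simp)).mono_left nhdsWithin_le_nhds
    · filter_upwards [self_mem_nhdsWithin] with r hr1 hrl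
      have : (r : ℂ) = 1 := mul_right_cancel₀ hl0 (by simpa using hrl)
      exact (ne_of_gt hr1) (by exact_mod_cast this)
  have h1 : Tendsto (fun r : ℝ => ‖g ((r : ℂ) * l) x‖) (𝓝[>] 1) (𝓝 ‖g l x‖) := by
    have hc : ContinuousAt (fun μ => ‖g μ x‖) l :=
      (hg.continuousAt.clm_apply continuousAt_const).norm
    exact hc.tendsto.comp (htend.mono_right nhdsWithin_le_nhds)
  have h2 : Tendsto (fun r : ℝ => (r - 1) ^ m * ‖resolvent T (r : ℂ)‖ * ‖modulus x‖)
      (𝓝[>] 1) (𝓝 0) := by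
    simpa using hlim.mul_const ‖modulus x‖
  have hle : ‖g l x‖ ≤ 0 := by
    refine le_of_tendsto_of_tendsto h1 h2 ?_
    filter_upwards [htend.eventually hge, self_mem_nhdsWithin] with r hr' hr1
    have hr1' : (1 : ℝ) < r := hr1
    have hnorm : ‖(r : ℂ) * l‖ = r := by
      rw [norm_mul, hl, mul_one, Complex.norm_real, Real.norm_of_nonneg (by linarith)]
    have hsub : ‖(r : ℂ) * l - l‖ = r - 1 := by
      rw [← sub_one_mul, norm_mul, hl, mul_one, ← Complex.ofReal_one, ← Complex.ofReal_sub,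
        Complex.norm_real, Real.norm_of_nonneg (by linarith)]
    have hbd := hT.norm_resolvent_apply_le hr (μ := (r : ℂ) * l) (by rwa [hnorm]) hx
    rw [hnorm] at hbd
    rw [← hr', smul_apply, norm_smul, norm_pow, hsub, mul_assoc]
    exact mul_le_mul_of_nonneg_left (hbd.trans (ContinuousLinearMap.le_opNorm _ _))
      (pow_nonneg (by linarith) m)
  exact norm_le_zero_iff.1 hle

theorem IsPositiveOp.one_mem_spectrum {T : E →L[ℂ] E} (hT : IsPositiveOp T)
    (hr : spectralRadius ℂ T = 1)
    (hpoles : ∀ μ ∈ spectrum ℂ T, ‖μ‖ = 1 → ∃ m : ℕ, 1 ≤ m ∧ HasResolventPoleOfOrder T μ m) :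
    (1 : ℂ) ∈ spectrum ℂ T := by
  have hne : (spectrum ℂ T).Nonempty := by
    by_contra hempty
    rw [Set.not_nonempty_iff_eq_empty] at hempty
    simp [spectralRadius, hempty] at hr
  obtain ⟨l, hl, hlr⟩ := spectrum.exists_nnnorm_eq_spectralRadius_of_nonempty hne
  have hl1 : ‖l‖ = 1 := by
    rw [hr] at hlr
    exact congrArg NNReal.toReal (ENNReal.coe_eq_one.1 hlr)
  obtain ⟨m, hm, hpole⟩ := hpoles l hl hl1
  by_contra h1
  have hres : (1 : ℂ) ∈ resolventSet ℂ T := not_not.1 h1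
  refine hT.not_tendsto_of_pole hr hl1 hpole ?_
  have hc : ContinuousAt (fun r : ℝ => (r - 1) ^ m * ‖resolvent T (r : ℂ)‖) 1 := by
    refine ContinuousAt.mul (by fun_prop) (ContinuousAt.norm ?_)
    refine ContinuousAt.comp (g := resolvent T) (f := fun r : ℝ => (r : ℂ)) ?_ (by fun_prop)
    rw [Complex.ofReal_one]
    exact (spectrum.hasDerivAt_resolvent_const_left hres).continuousAt
  have := hc.tendsto.mono_left (nhdsWithin_le_nhds (s := Set.Ioi 1))
  simpa [show m ≠ 0 by omega] using this

theorem IsPositiveOp.simple_pole_of_simple_pole_one {T : E →L[ℂ] E} (hT : IsPositiveOp T)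
    (hr : spectralRadius ℂ T = 1) (h1 : HasResolventPoleOfOrder T 1 1) {l : ℂ} (hl : ‖l‖ = 1)
    {m : ℕ} (hm : 1 ≤ m) (h : HasResolventPoleOfOrder T l m) : HasResolventPoleOfOrder T l 1 := by
  rcases hm.eq_or_lt with rfl | hm
  · exact h
  refine absurd ?_ (hT.not_tendsto_of_pole hr hl h)
  obtain ⟨-, -, g, hg, -, hge⟩ := h1
  have htend : Tendsto (fun r : ℝ => (r : ℂ)) (𝓝[>] 1) (𝓝[≠] 1) := by
    refine tendsto_nhdsWithin_iff.2 ⟨?_, ?_⟩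
    · exact (Complex.continuous_ofReal.tendsto' 1 1 Complex.ofReal_one).mono_left nhdsWithin_le_nhds
    · filter_upwards [self_mem_nhdsWithin] with r hr1 hrl
      exact (ne_of_gt (Set.mem_Ioi.1 hr1)) (by simpa using hrl)
  have hpow : Tendsto (fun r : ℝ => (r - 1) ^ (m - 1)) (𝓝[>] 1) (𝓝 0) := by
    have : Continuous fun r : ℝ => (r - 1) ^ (m - 1) := by fun_prop
    exact (this.tendsto' 1 0 (by simp [show m - 1 ≠ 0 by omega])).mono_left nhdsWithin_le_nhds
  have hlim := hpow.mul
    ((hg.continuousAt.tendsto.comp (htend.mono_right nhdsWithin_le_nhds)).norm)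
  rw [zero_mul] at hlim
  refine hlim.congr' ?_
  filter_upwards [htend.eventually hge, self_mem_nhdsWithin] with r hr' hr1
  have hr1' : (1 : ℝ) < r := hr1
  have hsub : ‖(r : ℂ) - 1‖ = r - 1 := by
    rw [← Complex.ofReal_one, ← Complex.ofReal_sub, Complex.norm_real,
      Real.norm_of_nonneg (by linarith)]
  rw [Function.comp_apply, ← hr', pow_one, norm_smul, hsub, ← mul_assoc, ← pow_succ,
    Nat.sub_add_cancel (by omega)]

end Lattice

/-- **Corollary 4.11.** Let `T` be a positive operator on a complex Banach lattice `E` with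
`r(T) = 1`, and suppose every peripheral spectral value of `T` is a pole of the resolvent.
Then the following are equivalent: (i) for every weighting scheme `(f_j)` the set
`{f_j(T)}` is bounded in operator norm; (ii) `T` is (WS)-bounded; (iii) `r(T) = 1` is a
first order pole of the resolvent; (iv) every peripheral spectral value of `T` is a first
order pole of the resolvent. -/
theorem ws_bounded_tfae_of_peripheral_poles
    {E : Type*} [NormedAddCommGroup E] [NormedSpace ℂ E] [CompleteSpace E] [PartialOrder E]
    [ComplexBanachLattice E]
    (T : E →L[ℂ] E) (hT : IsPositiveOp T)
    (hr : spectralRadius ℂ T = 1)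
    (hpoles : ∀ μ ∈ spectrum ℂ T, ‖μ‖ = 1 → ∃ m : ℕ, 1 ≤ m ∧ HasResolventPoleOfOrder T μ m) :
    ((∀ (J : Type) (F : Filter J), F.NeBot → ∀ a : J → ℕ → ℂ, IsWeightingScheme F a →
        ∃ C : ℝ, ∀ j : J, ‖wsApply (a j) T‖ ≤ C) ↔ WSBounded T) ∧
    (WSBounded T ↔ HasResolventPoleOfOrder T 1 1) ∧
    (HasResolventPoleOfOrder T 1 1 ↔
      ∀ μ ∈ spectrum ℂ T, ‖μ‖ = 1 → HasResolventPoleOfOrder T μ 1) := by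
  have h1 := hT.one_mem_spectrum hr hpoles
  have h12 : (∀ (J : Type) (F : Filter J), F.NeBot → ∀ a : J → ℕ → ℂ, IsWeightingScheme F a →
      ∃ C : ℝ, ∀ j : J, ‖wsApply (a j) T‖ ≤ C) → WSBounded T := fun h =>
    ⟨ℕ, atTop, inferInstance, _, isWeightingScheme_powers,
      h ℕ atTop inferInstance _ isWeightingScheme_powers⟩
  have h23 : WSBounded T → HasResolventPoleOfOrder T 1 1 := fun h => by
    obtain ⟨m, hm, hpole⟩ := hpoles 1 h1 norm_one
    rcases hm.eq_or_lt with rfl | hm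
    · exact hpole
    obtain ⟨S, Q, hS0, hS, hQ⟩ := exists_jordan_chain hm hpole
    exact absurd h (not_wsBounded_of_jordan_chain hr hS0 hS hQ)
  have h34 : HasResolventPoleOfOrder T 1 1 →
      ∀ μ ∈ spectrum ℂ T, ‖μ‖ = 1 → HasResolventPoleOfOrder T μ 1 := fun h μ hμ hμ1 => by
    obtain ⟨m, hm, hpole⟩ := hpoles μ hμ hμ1
    exact hT.simple_pole_of_simple_pole_one hr h hμ1 hm hpole
  have h41 : (∀ μ ∈ spectrum ℂ T, ‖μ‖ = 1 → HasResolventPoleOfOrder T μ 1) →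
      ∀ (J : Type) (F : Filter J), F.NeBot → ∀ a : J → ℕ → ℂ, IsWeightingScheme F a →
        ∃ C : ℝ, ∀ j : J, ‖wsApply (a j) T‖ ≤ C := fun h J F _ a ha => by
    obtain ⟨C, hC⟩ := exists_norm_pow_le_of_simple_poles hr h
    exact ⟨C, fun j => norm_wsApply_le hC (ha.1 j).summable (ha.2.2.1 j) (ha.2.1 j)⟩
  exact ⟨⟨h12, fun h => h41 (h34 (h23 h))⟩, ⟨h23, fun h => h12 (h41 (h34 h))⟩,
    ⟨h34, fun h => h 1 h1 norm_one⟩⟩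

end
end

section
/- Let T be a positive operator on a complex Banach lattice E with r(T) = 1. Suppose 0 ≤ x ∈ E and the sequence (T^n x)_{n∈ℕ₀} is non-decreasing. If T is (WS)-bounded, then the sequence (T^n x)_{n∈ℕ₀} is bounded in norm. -/
open scoped ComplexOrder ENNReal
open Filter Topology

noncomputable section

namespace ComplexBanachLattice

variable {E : Type*} [NormedAddCommGroup E] [NormedSpace ℂ E] [PartialOrder E]
  [ComplexBanachLattice E]

/-- The order of a complex Banach lattice is translation invariant. -/
theorem isOrderedAddMonoid : IsOrderedAddMonoid E where
  add_le_add_left x y h z := by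
    rw [ComplexBanachLattice.le_iff_sub_nonneg] at h ⊢
    simpa using h

theorem modulus_of_nonneg {x : E} (hx : 0 ≤ x) : ComplexBanachLattice.modulus x = x := by
  have : IsOrderedAddMonoid E := isOrderedAddMonoid
  refine (modulus_isLUB x (nonneg_mem_real x hx)).unique ⟨?_, fun b hb => hb (by simp)⟩
  rintro y (rfl | rfl)
  · exact le_rfl
  · exact (neg_nonpos.2 hx).trans hx

theorem norm_le_norm_of_nonneg_of_le {x y : E} (hx : 0 ≤ x) (hxy : x ≤ y) : ‖x‖ ≤ ‖y‖ :=
  norm_mono x y (by rwa [modulus_of_nonneg hx, modulus_of_nonneg (hx.trans hxy)])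

theorem ofReal_smul_le_smul {x y : E} {r : ℝ} (hr : 0 ≤ r) (hxy : x ≤ y) :
    (r : ℂ) • x ≤ (r : ℂ) • y := by
  rw [le_iff_sub_nonneg] at hxy ⊢
  rw [← smul_sub]
  exact smul_nonneg r hr _ hxy

/-- A weighted partial sum of a non-decreasing sequence of positive elements dominates any term,
scaled by the total weight of the later indices. -/
theorem ofReal_sum_Ico_smul_le {u : ℕ → E} (hu : Monotone u) (hpos : ∀ k, 0 ≤ u k)
    {b : ℕ → ℝ} (hb : ∀ k, 0 ≤ b k) (n m : ℕ) :
    ((∑ k ∈ Finset.Ico n m, b k : ℝ) : ℂ) • u n ≤ ∑ k ∈ Finset.range m, (b k : ℂ) • u k := by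
  have : IsOrderedAddMonoid E := isOrderedAddMonoid
  rw [Complex.ofReal_sum, Finset.sum_smul]
  refine (Finset.sum_le_sum fun k hk =>
    ofReal_smul_le_smul (hb k) (hu (Finset.mem_Ico.1 hk).1)).trans ?_
  refine Finset.sum_le_sum_of_subset_of_nonneg (fun k hk => ?_)
    fun k _ _ => smul_nonneg _ (hb k) _ (hpos k)
  exact Finset.mem_range.2 (Finset.mem_Ico.1 hk).2

theorem norm_le_two_mul_norm_sum {u : ℕ → E} (hu : Monotone u) (hpos : ∀ k, 0 ≤ u k)
    {b : ℕ → ℝ} (hb : ∀ k, 0 ≤ b k) {n m : ℕ} (h : 1 / 2 ≤ ∑ k ∈ Finset.Ico n m, b k) :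
    ‖u n‖ ≤ 2 * ‖∑ k ∈ Finset.range m, (b k : ℂ) • u k‖ := by
  have hnonneg : 0 ≤ ∑ k ∈ Finset.Ico n m, b k := Finset.sum_nonneg fun k _ => hb k
  have h1 := norm_le_norm_of_nonneg_of_le (smul_nonneg _ hnonneg _ (hpos n))
    (ofReal_sum_Ico_smul_le hu hpos hb n m)
  rw [norm_smul, Complex.norm_of_nonneg hnonneg] at h1
  nlinarith [norm_nonneg (u n)]

end ComplexBanachLattice

theorem HasDiskRadius.summable_smul_pow {A : Type*} [NormedRing A] [NormedAlgebra ℂ A]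
    [CompleteSpace A] {a : ℕ → ℂ} (ha : HasDiskRadius a) {T : A}
    (hr : spectralRadius ℂ T ≤ 1) : Summable fun k => a k • T ^ k := by
  obtain ⟨ρ, hρ, hs⟩ := ha
  obtain ⟨s, hs1, hsρ⟩ := exists_between hρ
  have hs0 : 0 ≤ s := by linarith
  have hsum : Summable fun k => ‖a k * (s : ℂ) ^ k‖ :=
    (hs s (by rwa [Complex.norm_of_nonneg hs0])).norm
  have hlt : spectralRadius ℂ T < ENNReal.ofReal s :=
    hr.trans_lt (by simpa using hs1)
  have hev := (spectrum.pow_norm_pow_one_div_tendsto_nhds_spectralRadius T).eventually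
    (gt_mem_nhds hlt)
  refine Summable.of_norm_bounded_eventually_nat hsum ?_
  filter_upwards [hev, eventually_ge_atTop 1] with k hk hk1
  rw [norm_smul, norm_mul, norm_pow (s : ℂ), Complex.norm_of_nonneg hs0]
  refine mul_le_mul_of_nonneg_left ?_ (norm_nonneg _)
  have hlt' := (ENNReal.ofReal_lt_ofReal_iff (by linarith)).1 hk
  have hk0 : (k : ℝ) ≠ 0 := by positivity
  calc ‖T ^ k‖ = (‖T ^ k‖ ^ (1 / k : ℝ)) ^ k := by
        rw [← Real.rpow_natCast, ← Real.rpow_mul (norm_nonneg _), one_div_mul_cancel hk0,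
          Real.rpow_one]
    _ ≤ s ^ k := pow_le_pow_left₀ (by positivity) hlt'.le k

/-- Along a weighting scheme the mass carried by any fixed initial segment vanishes; in particular
at least half of the mass of some member eventually lies beyond a given index. -/
theorem IsWeightingScheme.exists_half_le_sum_Ico {J : Type*} {F : Filter J} [F.NeBot]
    {a : J → ℕ → ℂ} (ha : IsWeightingScheme F a) (n : ℕ) :
    ∃ j, ∀ᶠ m in atTop, 1 / 2 ≤ ∑ k ∈ Finset.Ico n m, (a j k).re := by
  obtain ⟨hrad, hone, hpos, hlim⟩ := ha
  have hev := (hlim (1 / 2) (by norm_num)).norm.eventually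
    (gt_mem_nhds (show ‖(0 : ℂ)‖ < (1 / 2) ^ n / 4 by rw [norm_zero]; positivity))
  obtain ⟨j, hj⟩ := hev.exists
  have hb : ∀ k, 0 ≤ (a j k).re := fun k => (Complex.le_def.1 (hpos j k)).1
  have hre : HasSum (fun k => (a j k).re) 1 := by
    have := Complex.hasSum_re (hrad j).summable.hasSum
    rwa [hone, Complex.one_re] at this
  have hhalf : Summable fun k => a j k * (1 / 2) ^ k := by
    obtain ⟨ρ, hρ, hs⟩ := hrad j
    exact hs _ (by norm_num; linarith)
  have hre' : ∀ k, (a j k * (1 / 2) ^ k).re = (a j k).re * (1 / 2) ^ k := fun k => by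
    rw [show ((1 / 2 : ℂ) ^ k) = (((1 / 2 : ℝ) ^ k : ℝ) : ℂ) by push_cast; rfl,
      Complex.re_mul_ofReal]
  have hhalf' := Complex.hasSum_re hhalf.hasSum
  simp only [hre'] at hhalf'
  have hinit : ∑ k ∈ Finset.range n, (a j k).re ≤ 1 / 4 := by
    have h1 := sum_le_hasSum (Finset.range n)
      (fun k _ => mul_nonneg (hb k) (by positivity)) hhalf'
    have h2 : (∑ k ∈ Finset.range n, (a j k).re) * (1 / 2) ^ n
        ≤ ∑ k ∈ Finset.range n, (a j k).re * (1 / 2) ^ k := by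
      rw [Finset.sum_mul]
      refine Finset.sum_le_sum fun k hk => mul_le_mul_of_nonneg_left ?_ (hb k)
      exact pow_le_pow_of_le_one (by norm_num) (by norm_num) (Finset.mem_range.1 hk).le
    have h3 := Complex.re_le_norm (∑' k, a j k * (1 / 2) ^ k)
    have h4 : (0 : ℝ) < (1 / 2) ^ n := by positivity
    refine le_of_mul_le_mul_right ?_ h4
    linarith
  refine ⟨j, ?_⟩
  filter_upwards [hre.tendsto_sum_nat.eventually
    (lt_mem_nhds (show (3 / 4 : ℝ) < 1 by norm_num)), eventually_ge_atTop n] with m hm hnm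
  rw [Finset.sum_Ico_eq_sub _ hnm]
  linarith

/-- **Lemma 4.12.** Let `T` be a positive operator on a complex Banach lattice `E` with
`r(T) = 1`. Suppose `0 ≤ x ∈ E` and the sequence `(T^n x)` is non-decreasing. If `T` is
(WS)-bounded, then `(T^n x)` is bounded in norm. -/
theorem ws_bounded_monotone_orbit_bounded
    {E : Type*} [NormedAddCommGroup E] [NormedSpace ℂ E] [CompleteSpace E] [PartialOrder E]
    [ComplexBanachLattice E]
    (T : E →L[ℂ] E) (hT : IsPositiveOp T)
    (hr : spectralRadius ℂ T = 1)
    (x : E) (hx : 0 ≤ x)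
    (hmono : Monotone fun n : ℕ => (T ^ n) x)
    (hws : WSBounded T) :
    ∃ C : ℝ, ∀ n : ℕ, ‖(T ^ n) x‖ ≤ C := by
  obtain ⟨J, F, hF, a, ha, C, hC⟩ := hws
  have hpos : ∀ k, 0 ≤ (T ^ k) x := fun k =>
    hx.trans (by simpa using hmono (Nat.zero_le k))
  refine ⟨2 * (C * ‖x‖), fun n => ?_⟩
  obtain ⟨j, hj⟩ := ha.exists_half_le_sum_Ico n
  obtain ⟨hrad, -, hnonneg, -⟩ := ha
  have hsum : HasSum (fun k => a j k • (T ^ k) x) (wsApply (a j) T x) :=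
    ((hrad j).summable_smul_pow hr.le).hasSum.mapL (ContinuousLinearMap.apply ℂ E x)
  have hb : ∀ k, ((a j k).re : ℂ) = a j k := fun k =>
    (Complex.eq_re_of_ofReal_le (r := 0) (by simpa using hnonneg j k)).symm
  have hle : ‖(T ^ n) x‖ ≤ 2 * ‖wsApply (a j) T x‖ := by
    refine ge_of_tendsto (hsum.tendsto_sum_nat.norm.const_mul 2) ?_
    filter_upwards [hj] with m hm
    simpa only [hb] using ComplexBanachLattice.norm_le_two_mul_norm_sum hmono hpos
      (fun k => (Complex.le_def.1 (hnonneg j k)).1) hm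
  have hop : ‖wsApply (a j) T x‖ ≤ C * ‖x‖ :=
    (wsApply (a j) T).le_of_opNorm_le (hC j) x
  linarith

end
end
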